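/- Let d be a natural number and let f be an algebraic invariant of d-way complex tensors, i.e. for every format n : Fin d → ℕ a function f_n from d-way tensors of format n to the nonnegative reals satisfying f_n(σT) = f_n(T) for every tensor T and every field automorphism σ of ℂ. Then the set of all values taken by f, as n ranges over all formats and T over all tensors of format n, is at most countably infinite. -/

import Mathlib

open Cardinal in
/-- Two uncountable equipotent algebraically closed extensions of a countable ring `R` are
isomorphic over `R`. -/
theorem IsAlgClosed.nonempty_algEquiv_of_countable.{u, v, w} {R : Type u} {K : Type v}
    {L : Type w} [CommRing R] [Countable R] [Nontrivial R] [Field K] [Field L] [Algebra R K] [Algebra R L] [FaithfulSMul R K]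
    [FaithfulSMul R L] [IsAlgClosed K] [IsAlgClosed L] (hK : ℵ₀ < #K)
    (hKL : Nonempty (K ≃ L)) : Nonempty (K ≃ₐ[R] L) := by
  obtain ⟨s, hs⟩ := exists_isTranscendenceBasis R K
  obtain ⟨t, ht⟩ := exists_isTranscendenceBasis R L
  have hL : ℵ₀ < #L := by
    rwa [← aleph0_lt_lift.{w, v}, ← lift_mk_eq'.2 hKL, aleph0_lt_lift]
  have hst : Cardinal.lift.{w} #s = Cardinal.lift.{v} #t := by
    rw [← lift_injective (cardinal_eq_cardinal_transcendence_basis_of_aleph0_lt _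
        hs mk_le_aleph0 hK),
      ← lift_injective (cardinal_eq_cardinal_transcendence_basis_of_aleph0_lt _
        ht mk_le_aleph0 hL)]
    exact Cardinal.lift_mk_eq'.2 hKL
  obtain ⟨e⟩ := Cardinal.lift_mk_eq'.1 hst
  let := isAlgClosure_of_transcendence_basis _ hs
  let := isAlgClosure_of_transcendence_basis _ ht
  let ε := (hs.1.aevalEquiv.symm.trans (MvPolynomial.renameEquiv R e)).trans ht.1.aevalEquiv
  refine ⟨AlgEquiv.ofRingEquiv (f := IsAlgClosure.equivOfEquiv K L ε.toRingEquiv) fun r => ?_⟩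
  rw [IsScalarTower.algebraMap_apply R (Algebra.adjoin R (Set.range (Subtype.val : s → K))) K,
    IsAlgClosure.equivOfEquiv_algebraMap]
  simp [-Subtype.range_coe_subtype]

open Cardinal in
/-- Two embeddings of a countable ring into uncountable equipotent algebraically closed fields
differ by an isomorphism of these fields. -/
theorem IsAlgClosed.exists_ringEquiv_of_injective {R K L : Type*} [CommRing R] [Countable R]
    [Nontrivial R] [Field K] [Field L] [IsAlgClosed K] [IsAlgClosed L] {φ : R →+* K}
    {ψ : R →+* L} (hφ : Function.Injective φ) (hψ : Function.Injective ψ) (hK : ℵ₀ < #K)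
    (hKL : Nonempty (K ≃ L)) : ∃ σ : K ≃+* L, ∀ r, σ (φ r) = ψ r := by
  let _ := φ.toAlgebra
  let _ := ψ.toAlgebra
  have : FaithfulSMul R K := (faithfulSMul_iff_algebraMap_injective R K).2 hφ
  have : FaithfulSMul R L := (faithfulSMul_iff_algebraMap_injective R L).2 hψ
  obtain ⟨σ⟩ := nonempty_algEquiv_of_countable (R := R) hK hKL
  exact ⟨σ.toRingEquiv, σ.commutes⟩

/-- Polynomials in countably many variables over a countable ring form a countable set. -/
theorem MvPolynomial.countable (ι R : Type*) [CommSemiring R] [Countable ι] [Countable R] :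
    Countable (MvPolynomial ι R) := by
  rw [← Cardinal.mk_le_aleph0_iff]
  refine MvPolynomial.cardinalMk_le_max_lift.trans ?_
  simp [Cardinal.mk_le_aleph0]

/-- Complex tuples satisfying the same integral polynomial relations are conjugate under a field
automorphism of `ℂ`. -/
theorem Complex.exists_ringEquiv_of_ker_aeval_eq {ι : Type*} [Countable ι] {S T : ι → ℂ}
    (h : RingHom.ker (MvPolynomial.aeval (R := ℤ) S) =
      RingHom.ker (MvPolynomial.aeval (R := ℤ) T)) :
    ∃ σ : ℂ ≃+* ℂ, ∀ i, σ (S i) = T i := by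
  let I := RingHom.ker (MvPolynomial.aeval (R := ℤ) S)
  let R := MvPolynomial ι ℤ ⧸ I
  let φ : R →+* ℂ := Ideal.Quotient.lift I (MvPolynomial.aeval S).toRingHom fun _ ha => ha
  let ψ : R →+* ℂ := Ideal.Quotient.lift I (MvPolynomial.aeval T).toRingHom fun _ ha => h.le ha
  have hφ : Function.Injective φ :=
    RingHom.lift_injective_of_ker_le_ideal _ _ fun _ ha => ha
  have hψ : Function.Injective ψ :=
    RingHom.lift_injective_of_ker_le_ideal _ _ fun _ ha => h.ge ha
  have := MvPolynomial.countable ι ℤ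
  have : Countable R := Ideal.Quotient.mk_surjective.countable
  have : Nontrivial R := φ.domain_nontrivial
  obtain ⟨σ, hσ⟩ : ∃ σ : ℂ ≃+* ℂ, ∀ r, σ (φ r) = ψ r :=
    IsAlgClosed.exists_ringEquiv_of_injective hφ hψ
      (Cardinal.mk_complex ▸ Cardinal.aleph0_lt_continuum) ⟨Equiv.refl ℂ⟩
  refine ⟨σ, fun i => ?_⟩
  have hi : σ (MvPolynomial.aeval S (MvPolynomial.X i)) =
      MvPolynomial.aeval T (MvPolynomial.X i) := hσ (Ideal.Quotient.mk I (MvPolynomial.X i))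
  simpa using hi

/-- A countable Noetherian ring has countably many ideals. -/
theorem Ideal.countable_of_isNoetherianRing (R : Type*) [CommRing R] [Countable R]
    [IsNoetherianRing R] : Countable (Ideal R) := by
  refine Function.Surjective.countable (f := fun s : Finset R => Ideal.span (s : Set R)) ?_
  intro I
  exact (isNoetherianRing_iff_ideal_fg R).1 inferInstance I

/-- An algebraic invariant of `d`-way complex tensors takes at most
countably many values, as the format `n` and the tensor `T` vary. -/
theorem countable_values_of_algebraic_invariant (d : ℕ)
    (f : (n : Fin d → ℕ) → (((i : Fin d) → Fin (n i)) → ℂ) → NNReal)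
    (hf : ∀ (n : Fin d → ℕ) (T : ((i : Fin d) → Fin (n i)) → ℂ) (σ : ℂ ≃+* ℂ),
      f n (fun α => σ (T α)) = f n T) :
    {y : NNReal | ∃ (n : Fin d → ℕ) (T : ((i : Fin d) → Fin (n i)) → ℂ),
      f n T = y}.Countable := by
  suffices h : ∀ n, (Set.range (f n)).Countable by
    refine (Set.countable_iUnion h).mono ?_
    rintro _ ⟨n, T, rfl⟩
    exact Set.mem_iUnion.2 ⟨n, T, rfl⟩
  intro n
  have := MvPolynomial.countable ((i : Fin d) → Fin (n i)) ℤ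
  have := Ideal.countable_of_isNoetherianRing (MvPolynomial ((i : Fin d) → Fin (n i)) ℤ)
  let k : (((i : Fin d) → Fin (n i)) → ℂ) → Ideal (MvPolynomial ((i : Fin d) → Fin (n i)) ℤ) :=
    fun T => RingHom.ker (MvPolynomial.aeval (R := ℤ) T)
  have hk : Function.FactorsThrough (f n) k := fun S T h => by
    obtain ⟨σ, hσ⟩ := Complex.exists_ringEquiv_of_ker_aeval_eq h
    rw [← hf n S σ, funext hσ]
  refine (Set.countable_range (Function.extend k (f n) 0)).mono ?_
  rintro _ ⟨T, rfl⟩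
  exact ⟨k T, hk.extend_apply 0 T⟩
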